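/- Let C be the set of cubic forms f ∈ ℂ[x₀,…,x₅] such that the projective cubic fourfold {f = 0} ⊂ ℙ⁵ is smooth (i.e., the six partial derivatives ∂f/∂xᵢ have no common zero in ℂ⁶ ∖ {0}) and f has a partial derivative of rank at most 3, i.e., there exists v ∈ ℂ⁶ ∖ {0} with rank(∂_v f) ≤ 3. Then the vanishing ideal of C (in the polynomial ring on the 56 coefficients of a cubic form in 6 variables) is a prime ideal of height 1; equivalently, the Zariski closure of C is an irreducible hypersurface in the 56-dimensional space of cubic forms. (Lemma 2.1 of the paper: the divisor D_{rk3} is an irreducible divisor.) -/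

import Mathlib

open MvPolynomial

/-- The constant-coefficient differential operator associated with the monomial
exponent `d`: the composition over `i` of `(∂/∂xᵢ)^(d i)`. -/
noncomputable def monOp {n : ℕ} (d : Fin n →₀ ℕ) :
    Module.End ℂ (MvPolynomial (Fin n) ℂ) :=
  (List.ofFn fun i : Fin n =>
    ((pderiv (R := ℂ) i).toLinearMap : Module.End ℂ (MvPolynomial (Fin n) ℂ)) ^ (d i)).prod

/-- The apolarity action `g ∘ f` : apply `g`, viewed as a constant-coefficient
differential operator, to `f`. -/
noncomputable def apolar {n : ℕ} (g f : MvPolynomial (Fin n) ℂ) :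
    MvPolynomial (Fin n) ℂ :=
  ∑ d ∈ g.support, coeff d g • monOp d f

/-- The apolarity pairing `⟨f, k⟩ := k ∘ f` (its constant term). -/
noncomputable def pairing {n : ℕ} (f k : MvPolynomial (Fin n) ℂ) : ℂ :=
  eval (fun _ => (0 : ℂ)) (apolar k f)

/-- The linear form `Σ vᵢ xᵢ` associated with a vector `v`. -/
noncomputable def linForm {n : ℕ} (v : Fin n → ℂ) : MvPolynomial (Fin n) ℂ :=
  ∑ i, MvPolynomial.C (v i) * X i

/-- The directional partial derivative `∂_v f = Σ vᵢ ∂f/∂xᵢ`. -/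
noncomputable def pdir {n : ℕ} (v : Fin n → ℂ) (f : MvPolynomial (Fin n) ℂ) :
    MvPolynomial (Fin n) ℂ :=
  ∑ i, MvPolynomial.C (v i) * pderiv i f

/-- The Veronese map `ν : ℂ³ → ℂ⁶`. -/
noncomputable def nu (w : Fin 3 → ℂ) : Fin 6 → ℂ :=
  ![w 0 ^ 2, 2 * w 0 * w 1, 2 * w 0 * w 2, w 1 ^ 2, 2 * w 1 * w 2, w 2 ^ 2]

/-- The components of the Veronese map as quadratic forms in `y₀, y₁, y₂`. -/
noncomputable def nuPoly : Fin 6 → MvPolynomial (Fin 3) ℂ :=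
  ![X 0 ^ 2, 2 * X 0 * X 1, 2 * X 0 * X 2, X 1 ^ 2, 2 * X 1 * X 2, X 2 ^ 2]

/-- A quadratic form `q` in 6 variables has rank `≤ r`: there is a symmetric matrix
`M` of rank `≤ r` with `q(x) = xᵀ M x`. -/
def QuadRankLe (q : MvPolynomial (Fin 6) ℂ) (r : ℕ) : Prop :=
  ∃ M : Matrix (Fin 6) (Fin 6) ℂ, M.IsSymm ∧ M.rank ≤ r ∧
    ∀ x : Fin 6 → ℂ, eval x q = ∑ i, ∑ j, M i j * x i * x j

/-- `s` is the linear map carrying a ternary sextic `g` to the cubic `s(g)` in six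
variables, characterized by `⟨s(g), k⟩ = ⟨g, m(k)⟩` for all cubic forms `k`, where
`m(k) = k ∘ ν`. -/
def IsSMap (s : MvPolynomial (Fin 3) ℂ →ₗ[ℂ] MvPolynomial (Fin 6) ℂ) : Prop :=
  (∀ g : MvPolynomial (Fin 3) ℂ, g.IsHomogeneous 6 → (s g).IsHomogeneous 3) ∧
  ∀ g : MvPolynomial (Fin 3) ℂ, ∀ k : MvPolynomial (Fin 6) ℂ,
    g.IsHomogeneous 6 → k.IsHomogeneous 3 →
      pairing (s g) k = pairing g (aeval nuPoly k)

/-- Evaluation of a polynomial function `P` in the coefficients at a polynomial `g`. -/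
noncomputable def evalCoeff {σ : Type} (g : MvPolynomial σ ℂ) (P : MvPolynomial (σ →₀ ℕ) ℂ) : ℂ :=
  eval (fun d => coeff d g) P

/-- The vanishing ideal of a subset of `ℂ⁵⁶`. -/
noncomputable def vanishingIdealOf (S : Set (Fin 56 → ℂ)) : Ideal (MvPolynomial (Fin 56) ℂ) :=
  ⨅ x ∈ S, RingHom.ker (eval x)

/-- An ideal is a prime ideal of height one: it is prime, admits a prime strictly
below it, and admits no chain of two primes strictly below it. -/
def IsHeightOnePrime {R : Type*} [CommRing R] (I : Ideal R) : Prop :=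
  I.IsPrime ∧ (∃ p : Ideal R, p.IsPrime ∧ p < I) ∧
    ∀ p q : Ideal R, p.IsPrime → q.IsPrime → p < q → ¬ q < I

/-- The space `Q_{f,U}` of quadratic forms vanishing on `U` and apolar to `f`. -/
def QfU (f : MvPolynomial (Fin 6) ℂ) (U : Submodule ℂ (Fin 6 → ℂ)) :
    Set (MvPolynomial (Fin 6) ℂ) :=
  {q | q.IsHomogeneous 2 ∧ (∀ u ∈ U, eval u q = 0) ∧ apolar q f = 0}

/-- The Zariski closure of a subset of `ℂ⁵⁶`. -/
def zcl (S : Set (Fin 56 → ℂ)) : Set (Fin 56 → ℂ) :=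
  {x | ∀ P : MvPolynomial (Fin 56) ℂ, (∀ y ∈ S, eval y P = 0) → eval x P = 0}

/-- The projection of a polynomial onto its squarefree monomials. -/
noncomputable def sqfreeProj (f : MvPolynomial (Fin 6) ℂ) : MvPolynomial (Fin 6) ℂ :=
  ∑ d ∈ f.support.filter (fun d => ∀ i, d i ≤ 1), monomial d (coeff d f)


/-- A chain of three primes of `R[X]` cannot lie over the zero ideal of `R`. -/
lemma Polynomial.not_lt_of_lt_of_comap_C_eq_bot {R : Type*} [CommRing R] [IsDomain R]
    {p q I : Ideal (Polynomial R)} (hp : p.IsPrime) (hq : q.IsPrime) (hI : I.IsPrime)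
    (hC : I.comap (Polynomial.C : R →+* Polynomial R) = ⊥) (hpq : p < q) : ¬ q < I := by
  intro hqI
  let K := FractionRing R
  let M := (nonZeroDivisors R).map (Polynomial.C : R →+* Polynomial R)
  let := Polynomial.algebra R K
  have : IsLocalization M (Polynomial K) := Polynomial.isLocalization (nonZeroDivisors R) K
  have hdisj : ∀ J : Ideal (Polynomial R), J ≤ I → Disjoint (M : Set (Polynomial R)) J := by
    intro J hJ
    rw [Set.disjoint_left]
    rintro _ ⟨r, hr, rfl⟩ hrJ
    have : r ∈ I.comap (Polynomial.C : R →+* Polynomial R) := hJ hrJ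
    rw [hC] at this
    exact nonZeroDivisors.ne_zero hr this
  let o := (IsLocalization.orderIsoOfPrime M (Polynomial K)).symm
  let p' := o ⟨p, hp, hdisj p (hpq.le.trans hqI.le)⟩
  let q' := o ⟨q, hq, hdisj q hqI.le⟩
  let I' := o ⟨I, hI, hdisj I le_rfl⟩
  have h1 : p'.1 < q'.1 := o.strictMono (by exact hpq)
  have h2 : q'.1 < I'.1 := o.strictMono (by exact hqI)
  have hmax : q'.1.IsMaximal := q'.2.isMaximal (ne_bot_of_gt h1)
  exact I'.2.ne_top (hmax.1.2 _ h2)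

/-- A polynomial vanishing on a nonempty open set is zero. -/
lemma MvPolynomial.eq_zero_of_eval_eq_zero_of_isOpen {σ : Type*} [Fintype σ] {U : Set (σ → ℂ)}
    (hU : IsOpen U) (hne : U.Nonempty) {P : MvPolynomial σ ℂ} (h : ∀ y ∈ U, eval y P = 0) :
    P = 0 := by
  obtain ⟨y, hy⟩ := hne
  obtain ⟨r, hr, hball⟩ := Metric.isOpen_iff.1 hU y hy
  refine funext_set (fun i => Metric.ball (y i) r)
    (fun i => infinite_of_mem_nhds (y i) (Metric.ball_mem_nhds _ hr)) fun x hx => ?_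
  rw [map_zero]
  refine h x (hball ?_)
  rw [ball_pi _ hr]
  exact hx

/-- If the linear map `L` into `𝕜ⁿ⁺¹` is injective on an `n`-dimensional space, it stays so after
forgetting a suitable coordinate. -/
lemma LinearMap.exists_injective_comp_succAbove {𝕜 : Type*} [Field 𝕜] {n : ℕ}
    (L : (Fin n → 𝕜) →ₗ[𝕜] (Fin (n + 1) → 𝕜)) (hL : Function.Injective L) :
    ∃ i : Fin (n + 1), ∀ y, (∀ k, L y (i.succAbove k) = 0) → y = 0 := by
  have hr : LinearMap.range L ≠ ⊤ := by
    intro h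
    have := LinearMap.finrank_range_of_inj hL
    rw [h, finrank_top] at this
    simp at this
  obtain ⟨i, hi⟩ : ∃ i : Fin (n + 1), Pi.single i (1 : 𝕜) ∉ LinearMap.range L := by
    by_contra! h
    refine hr (eq_top_iff.2 ?_)
    rw [← (Pi.basisFun 𝕜 (Fin (n + 1))).span_eq, Submodule.span_le]
    rintro _ ⟨i, rfl⟩
    simpa using h i
  refine ⟨i, fun y hy => ?_⟩
  have hs : L y = L y i • Pi.single i (1 : 𝕜) := by
    ext k
    rcases Fin.eq_self_or_eq_succAbove i k with rfl | ⟨j, rfl⟩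
    · simp
    · simp [hy j]
  by_cases hc : L y i = 0
  · rw [hc, zero_smul] at hs
    exact hL (by rw [hs, map_zero])
  · refine absurd ⟨(L y i)⁻¹ • y, ?_⟩ hi
    rw [map_smul, hs]
    simp [smul_smul, inv_mul_cancel₀ hc]

lemma MvPolynomial.eval_aeval {σ τ : Type*} (p : σ → MvPolynomial τ ℂ) (P : MvPolynomial σ ℂ)
    (y : τ → ℂ) : eval y (aeval p P) = eval (fun i => eval y (p i)) P := by
  induction P using MvPolynomial.induction_on with
  | C a => simp
  | add p q hp hq => simp only [map_add, hp, hq]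
  | mul_X p i hp => simp only [map_mul, aeval_X, eval_X, hp]

lemma MvPolynomial.contDiff_eval {σ : Type*} [Fintype σ] (P : MvPolynomial σ ℂ) :
    ContDiff ℂ 1 (fun y : σ → ℂ => eval y P) := by
  have := (AnalyticOnNhd.eval_mvPolynomial (𝕜 := ℂ) P).contDiffOn (n := 1) uniqueDiffOn_univ
  exact contDiffOn_univ.1 this

/-- Polynomials with injective Jacobian matrix, as many as there are variables, are algebraically
independent. -/
lemma MvPolynomial.aeval_injective_of_fderiv_injective {n : ℕ}
    (p : Fin n → MvPolynomial (Fin n) ℂ) (y : Fin n → ℂ)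
    (h : Function.Injective (fderiv ℂ (fun z i => eval z (p i)) y)) :
    Function.Injective (aeval (R := ℂ) p) := by
  rw [injective_iff_map_eq_zero]
  intro P hP
  set Φ : (Fin n → ℂ) → (Fin n → ℂ) := fun z i => eval z (p i)
  have hΦ : ContDiff ℂ 1 Φ := contDiff_pi.2 fun i => contDiff_eval (p i)
  have hs : HasStrictFDerivAt Φ (fderiv ℂ Φ y) y := hΦ.contDiffAt.hasStrictFDerivAt one_ne_zero
  have hsurj : (fderiv ℂ Φ y).range = ⊤ :=
    LinearMap.range_eq_top.2 (LinearMap.injective_iff_surjective.1 h)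
  have hn := hs.map_nhds_eq_of_surj hsurj
  have hr : Set.range Φ ∈ nhds (Φ y) := by
    rw [← hn]
    exact Filter.range_mem_map
  refine eq_zero_of_eval_eq_zero_of_isOpen isOpen_interior
    ⟨Φ y, mem_interior_iff_mem_nhds.2 hr⟩ fun z hz => ?_
  obtain ⟨w, rfl⟩ := interior_subset hz
  have : eval w (aeval p P) = 0 := by rw [hP, map_zero]
  rw [← this, eval_aeval]

/-- The kernel of a polynomial parametrization `𝔸ⁿ → 𝔸ⁿ⁺¹` that is somewhere immersive is a prime
of height one. -/
lemma isHeightOnePrime_ker_aeval {n : ℕ} (p : Fin (n + 1) → MvPolynomial (Fin n) ℂ) (y : Fin n → ℂ)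
    (h : Function.Injective (fderiv ℂ (fun z i => eval z (p i)) y)) :
    IsHeightOnePrime (RingHom.ker (aeval (R := ℂ) p)) := by
  have hprime : (RingHom.ker (aeval (R := ℂ) p)).IsPrime := RingHom.ker_isPrime _
  refine ⟨hprime, ⟨⊥, Ideal.isPrime_bot, bot_lt_iff_ne_bot.2 fun hbot => ?_⟩, ?_⟩
  · have hai : AlgebraicIndependent ℂ p := by
      rw [algebraicIndependent_iff_injective_aeval]
      exact (RingHom.injective_iff_ker_eq_bot _).2 hbot
    have := hai.cardinalMk_le_trdeg
    rw [trdeg_of_isDomain] at this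
    simp only [Cardinal.mk_fin, Cardinal.lift_natCast, Nat.cast_le] at this
    omega
  · intro P Q hP hQ hPQ hQI
    obtain ⟨i, hi⟩ := LinearMap.exists_injective_comp_succAbove
      (fderiv ℂ (fun z i => eval z (p i)) y).toLinearMap h
    have hinj : Function.Injective (aeval (R := ℂ) fun k => p (i.succAbove k)) := by
      refine aeval_injective_of_fderiv_injective _ y ?_
      rw [injective_iff_map_eq_zero]
      intro z hz
      refine hi z fun k => ?_
      have hd : ∀ j, DifferentiableAt ℂ (fun z => eval z (p j)) y :=
        fun j => ((contDiff_eval (p j)).differentiable one_ne_zero) y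
      have := congrFun hz k
      rw [fderiv_pi fun k => hd (i.succAbove k)] at this
      change fderiv ℂ (fun z i => eval z (p i)) y z (i.succAbove k) = 0
      rw [fderiv_pi hd]
      exact this
    let ε := (renameEquiv ℂ (_root_.finSuccEquiv' i)).trans (optionEquivLeft ℂ (Fin n))
    have hε : ∀ r : MvPolynomial (Fin n) ℂ,
        ε.symm (Polynomial.C r) = rename i.succAbove r := by
      intro r
      rw [AlgEquiv.symm_apply_eq]
      change _ = optionEquivLeft ℂ (Fin n) (rename _ (rename _ r))
      rw [rename_rename]
      have : (⇑(_root_.finSuccEquiv' i) ∘ i.succAbove) = some := by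
        ext1 k; simp
      rw [this]
      induction r using MvPolynomial.induction_on with
      | C a => simp
      | add a b ha hb => simp [ha, hb]
      | mul_X a j ha => simp [ha]
    have hmono : StrictMono (Ideal.comap ε.symm.toRingEquiv) := by
      refine Monotone.strictMono_of_injective (fun _ _ => Ideal.comap_mono)
        (Ideal.comap_injective_of_surjective _ ε.symm.surjective)
    refine Polynomial.not_lt_of_lt_of_comap_C_eq_bot (hP.comap _) (hQ.comap _) (hprime.comap _) ?_
      (hmono hPQ) (hmono hQI)
    rw [eq_bot_iff]
    intro r hr
    have hr' : aeval p (ε.symm (Polynomial.C r)) = 0 := hr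
    rw [hε, aeval_rename] at hr'
    exact (injective_iff_map_eq_zero _).1 hinj r hr'

/-- The pullback of polynomials along the linear map `x ↦ A x`. -/
noncomputable def linSubst {n : ℕ} (A : Matrix (Fin n) (Fin n) ℂ) :
    MvPolynomial (Fin n) ℂ →ₐ[ℂ] MvPolynomial (Fin n) ℂ :=
  aeval fun i => linForm (A i)

lemma eval_linForm {n : ℕ} (v x : Fin n → ℂ) : eval x (linForm v) = ∑ i, v i * x i := by
  simp [linForm]

lemma isHomogeneous_linForm {n : ℕ} (v : Fin n → ℂ) : (linForm v).IsHomogeneous 1 :=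
  IsHomogeneous.sum _ _ _ fun i _ => by
    simpa using (isHomogeneous_C (Fin n) (v i)).mul (isHomogeneous_X ℂ i)

lemma pderiv_linForm {n : ℕ} (v : Fin n → ℂ) (j : Fin n) : pderiv j (linForm v) = C (v j) := by
  simp [linForm, pderiv_X, Pi.single_apply]

lemma eval_linSubst {n : ℕ} (A : Matrix (Fin n) (Fin n) ℂ) (f : MvPolynomial (Fin n) ℂ)
    (x : Fin n → ℂ) : eval x (linSubst A f) = eval (A.mulVec x) f := by
  induction f using MvPolynomial.induction_on with
  | C a => simp [linSubst]
  | add p q hp hq => simp [hp, hq]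
  | mul_X p i hp =>
    rw [map_mul, map_mul, hp, map_mul]
    simp [linSubst, eval_linForm, Matrix.mulVec, dotProduct]

lemma linSubst_mul {n : ℕ} (A B : Matrix (Fin n) (Fin n) ℂ) (f : MvPolynomial (Fin n) ℂ) :
    linSubst (A * B) f = linSubst B (linSubst A f) :=
  MvPolynomial.funext fun x => by simp [eval_linSubst]

lemma linSubst_one {n : ℕ} (f : MvPolynomial (Fin n) ℂ) : linSubst 1 f = f :=
  MvPolynomial.funext fun x => by simp [eval_linSubst]

lemma isHomogeneous_linSubst {n d : ℕ} (A : Matrix (Fin n) (Fin n) ℂ)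
    {f : MvPolynomial (Fin n) ℂ} (hf : f.IsHomogeneous d) : (linSubst A f).IsHomogeneous d := by
  simpa [linSubst] using hf.aeval (fun i => linForm (A i)) fun i => isHomogeneous_linForm (A i)

/-- The chain rule for a linear substitution. -/
lemma pderiv_linSubst {n : ℕ} (A : Matrix (Fin n) (Fin n) ℂ) (f : MvPolynomial (Fin n) ℂ)
    (j : Fin n) : pderiv j (linSubst A f) = ∑ i, C (A i j) * linSubst A (pderiv i f) := by
  induction f using MvPolynomial.induction_on with
  | C a => simp [linSubst]
  | add p q hp hq => simp [hp, hq, mul_add, Finset.sum_add_distrib]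
  | mul_X p k hp =>
    have hX : linSubst A (X k) = linForm (A k) := by simp [linSubst]
    simp only [map_mul, pderiv_mul, hp, hX, pderiv_linForm, map_add, mul_add,
      Finset.sum_add_distrib, pderiv_X, Pi.single_apply]
    congr 1
    · rw [Finset.sum_mul]
      exact Finset.sum_congr rfl fun i _ => by ring
    · simp [apply_ite (linSubst A), mul_comm]

lemma pdir_linSubst {n : ℕ} (A : Matrix (Fin n) (Fin n) ℂ) (f : MvPolynomial (Fin n) ℂ)
    (v : Fin n → ℂ) : pdir v (linSubst A f) = linSubst A (pdir (A.mulVec v) f) := by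
  have hC : ∀ c : ℂ, linSubst A (C c) = C c := fun c => by simp [linSubst]
  simp only [pdir, pderiv_linSubst, map_sum, map_mul, hC, Finset.mul_sum, Matrix.mulVec,
    dotProduct, Finset.sum_mul]
  rw [Finset.sum_comm]
  exact Finset.sum_congr rfl fun i _ => Finset.sum_congr rfl fun k _ => by ring

lemma pdir_single {n : ℕ} (f : MvPolynomial (Fin n) ℂ) (j : Fin n) :
    pdir (Pi.single j 1) f = pderiv j f := by
  simp [pdir, Pi.single_apply]

lemma pderiv_comm {σ : Type*} (i j : σ) (f : MvPolynomial σ ℂ) :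
    pderiv i (pderiv j f) = pderiv j (pderiv i f) := by
  ext m
  classical
  simp only [coeff_pderiv, Finsupp.add_apply, Finsupp.single_apply]
  rw [add_right_comm m]
  rcases eq_or_ne i j with rfl | h
  · rfl
  · simp [h, h.symm]
    ring

/-- The symmetric matrix of a quadratic form. -/
noncomputable def quadMatrix {n : ℕ} (q : MvPolynomial (Fin n) ℂ) : Matrix (Fin n) (Fin n) ℂ :=
  fun i j => 2⁻¹ * coeff 0 (pderiv i (pderiv j q))

lemma quadMatrix_isSymm {n : ℕ} (q : MvPolynomial (Fin n) ℂ) : (quadMatrix q).IsSymm := by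
  ext i j
  simp [quadMatrix, pderiv_comm i j]

lemma eval_eq_sum_quadMatrix {n : ℕ} {q : MvPolynomial (Fin n) ℂ} (hq : q.IsHomogeneous 2)
    (x : Fin n → ℂ) : eval x q = ∑ i, ∑ j, quadMatrix q i j * x i * x j := by
  have h1 : ∀ i, eval x (pderiv i q) = ∑ j, 2 * quadMatrix q i j * x j := by
    intro i
    have h := congrArg (eval x) (hq.pderiv (i := i)).sum_X_mul_pderiv
    simp only [map_sum, map_mul, eval_X, Nat.reduceSub, one_smul] at h
    rw [← h]
    refine Finset.sum_congr rfl fun j _ => ?_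
    have h0 : (pderiv j (pderiv i q)).IsHomogeneous 0 := (hq.pderiv (i := i)).pderiv
    rw [← totalDegree_zero_iff_isHomogeneous, totalDegree_eq_zero_iff_eq_C] at h0
    rw [h0, eval_C, quadMatrix, pderiv_comm i j]
    ring
  have h := congrArg (eval x) hq.sum_X_mul_pderiv
  simp only [map_sum, map_mul, eval_X, h1, map_nsmul] at h
  have h2 : eval x q = 2⁻¹ * ((2 : ℕ) • eval x q) := by rw [nsmul_eq_mul]; push_cast; ring
  rw [h2, ← h, Finset.mul_sum]
  refine Finset.sum_congr rfl fun i _ => ?_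
  rw [Finset.mul_sum, Finset.mul_sum]
  exact Finset.sum_congr rfl fun j _ => by ring

/-- The pairs `(a, b)` such that the monomials `x₀ xₐ x_b` are those divisible by `x₀` and by one of
`x₃, x₄, x₅`. -/
def mixedPair : Fin 15 → Fin 6 × Fin 6 :=
  ![(0, 3), (0, 4), (0, 5), (1, 3), (1, 4), (1, 5), (2, 3), (2, 4), (2, 5),
    (3, 3), (3, 4), (3, 5), (4, 4), (4, 5), (5, 5)]

/-- The exponent of `x₀ xₐ x_b`, for `(a, b)` the `k`-th mixed pair. -/
noncomputable def mixedExp (k : Fin 15) : Fin 6 →₀ ℕ :=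
  Finsupp.single (mixedPair k).1 1 + Finsupp.single (mixedPair k).2 1 + Finsupp.single 0 1

lemma mixedExp_injective : Function.Injective mixedExp := by
  have key : ∀ k l : Fin 15,
      (∀ i : Fin 6, (if (mixedPair k).1 = i then 1 else 0) + (if (mixedPair k).2 = i then 1 else 0) +
        (if 0 = i then 1 else 0) = (if (mixedPair l).1 = i then 1 else 0) +
        (if (mixedPair l).2 = i then 1 else 0) + (if 0 = i then 1 else 0)) → k = l := by
    decide +kernel
  intro k l h
  refine key k l fun i => ?_
  simpa only [mixedExp, Finsupp.add_apply, Finsupp.single_apply] using DFunLike.congr_fun h i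

/-- The coefficients of a cubic form at the mixed monomials. -/
noncomputable def mixedCoeff : homogeneousSubmodule (Fin 6) ℂ 3 →ₗ[ℂ] (Fin 15 → ℂ) :=
  LinearMap.pi fun k => (lcoeff ℂ (mixedExp k)).comp (homogeneousSubmodule (Fin 6) ℂ 3).subtype

lemma mixedCoeff_apply (F : homogeneousSubmodule (Fin 6) ℂ 3) (k : Fin 15) :
    mixedCoeff F k = coeff (mixedExp k) (F : MvPolynomial (Fin 6) ℂ) := rfl

lemma mixedCoeff_surjective : Function.Surjective mixedCoeff := by
  intro c
  refine ⟨⟨∑ k, monomial (mixedExp k) (c k), ?_⟩, ?_⟩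
  · refine Submodule.sum_mem _ fun k _ => isHomogeneous_monomial _ ?_
    simp [mixedExp]
  · ext k
    rw [mixedCoeff_apply]
    simp [coeff_sum, coeff_monomial, mixedExp_injective.eq_iff]

/-- The cubic forms `F` whose derivative `∂F/∂x₀` involves the variables `x₀, x₁, x₂` only. -/
noncomputable def adaptedCubics : Submodule ℂ (homogeneousSubmodule (Fin 6) ℂ 3) :=
  LinearMap.ker mixedCoeff

lemma mem_adaptedCubics {F : homogeneousSubmodule (Fin 6) ℂ 3} :
    F ∈ adaptedCubics ↔
      ∀ j : Fin 6, 3 ≤ j → pderiv j (pderiv 0 (F : MvPolynomial (Fin 6) ℂ)) = 0 := by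
  have hF : (F : MvPolynomial (Fin 6) ℂ).IsHomogeneous 3 := F.2
  rw [adaptedCubics, LinearMap.mem_ker, funext_iff]
  simp only [mixedCoeff_apply, Pi.zero_apply]
  constructor
  · intro h j hj
    ext m
    rw [coeff_pderiv, coeff_pderiv, coeff_zero]
    by_cases hm : m.degree = 1
    · obtain ⟨k, rfl⟩ : m ∈ Set.range fun a : Fin 6 => Finsupp.single a 1 := by
        rw [Finsupp.range_single_one]
        exact hm
      have key : ∀ k j : Fin 6, 3 ≤ j → ∃ l, mixedPair l = (k, j) ∨ mixedPair l = (j, k) := by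
        decide +kernel
      obtain ⟨l, hl⟩ := key k j hj
      have := h l
      rcases hl with hl | hl <;> rw [mixedExp, hl] at this
      · rw [this, zero_mul, zero_mul]
      · rw [add_comm (Finsupp.single k 1), this, zero_mul, zero_mul]
    · rw [hF.coeff_eq_zero, zero_mul, zero_mul]
      simp only [map_add, Finsupp.degree_single]
      omega
  · intro h k
    have h3 : ∀ k, 3 ≤ (mixedPair k).2 := by decide
    have h0 := congrArg (coeff (Finsupp.single (mixedPair k).1 1)) (h _ (h3 k))
    rw [coeff_pderiv, coeff_pderiv, coeff_zero] at h0
    rcases mul_eq_zero.1 h0 with h0 | h0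
    · rcases mul_eq_zero.1 h0 with h0 | h0
      · exact h0
      · exact absurd h0 (Nat.cast_add_one_ne_zero _)
    · exact absurd h0 (Nat.cast_add_one_ne_zero _)

lemma finrank_adaptedCubics
    (e : homogeneousSubmodule (Fin 6) ℂ 3 ≃ₗ[ℂ] (Fin 56 → ℂ)) :
    Module.finrank ℂ adaptedCubics = 41 := by
  have : Module.Finite ℂ (homogeneousSubmodule (Fin 6) ℂ 3) := Module.Finite.equiv e.symm
  have h := LinearMap.finrank_range_add_finrank_ker mixedCoeff
  rw [LinearMap.range_eq_top.2 mixedCoeff_surjective, finrank_top, e.finrank_eq] at h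
  simp only [Module.finrank_fin_fun] at h
  rw [adaptedCubics]
  omega

/-- Pulling back along a linear map that preserves `⟨e₀⟩` and `⟨e₃, e₄, e₅⟩` preserves adapted
cubics. -/
lemma linSubst_mem_adaptedCubics {F G : homogeneousSubmodule (Fin 6) ℂ 3} (hF : F ∈ adaptedCubics)
    {P : Matrix (Fin 6) (Fin 6) ℂ} (h0 : ∀ i, i ≠ 0 → P i 0 = 0)
    (h3 : ∀ i j, i < 3 → 3 ≤ j → P i j = 0)
    (hG : (G : MvPolynomial (Fin 6) ℂ) = linSubst P (F : MvPolynomial (Fin 6) ℂ)) :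
    G ∈ adaptedCubics := by
  rw [mem_adaptedCubics] at hF ⊢
  intro j hj
  rw [hG, pderiv_linSubst, Finset.sum_eq_single 0 (fun i _ hi => by simp [h0 i hi]) (by simp),
    pderiv_C_mul, pderiv_linSubst]
  rw [Finset.sum_eq_zero, mul_zero]
  intro i _
  rcases lt_or_ge i 3 with hi | hi
  · rw [h3 i j hi hj, C_0, zero_mul]
  · rw [hF i hi, map_zero, mul_zero]

lemma quadRankLe_linSubst {q : MvPolynomial (Fin 6) ℂ} {r : ℕ} (hq : QuadRankLe q r)
    (A : Matrix (Fin 6) (Fin 6) ℂ) : QuadRankLe (linSubst A q) r := by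
  obtain ⟨M, hs, hr, hM⟩ := hq
  have quad : ∀ (N : Matrix (Fin 6) (Fin 6) ℂ) (x : Fin 6 → ℂ),
      ∑ i, ∑ j, N i j * x i * x j = x ⬝ᵥ N.mulVec x := by
    intro N x
    simp only [dotProduct, Matrix.mulVec, Finset.mul_sum]
    exact Finset.sum_congr rfl fun i _ => Finset.sum_congr rfl fun j _ => by ring
  refine ⟨A.transpose * M * A, ?_, ?_, fun x => ?_⟩
  · simp only [Matrix.IsSymm, Matrix.transpose_mul, Matrix.transpose_transpose, hs.eq,
      Matrix.mul_assoc]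
  · exact ((Matrix.rank_mul_le_left _ _).trans (Matrix.rank_mul_le_right _ _)).trans hr
  · rw [eval_linSubst, hM, quad, quad, ← Matrix.mulVec_mulVec, ← Matrix.mulVec_mulVec,
      Matrix.dotProduct_mulVec x, Matrix.vecMul_transpose]

lemma quadRankLe_pderiv_of_mem_adaptedCubics {F : homogeneousSubmodule (Fin 6) ℂ 3}
    (hF : F ∈ adaptedCubics) : QuadRankLe (pderiv 0 (F : MvPolynomial (Fin 6) ℂ)) 3 := by
  rw [mem_adaptedCubics] at hF
  have hq : (pderiv 0 (F : MvPolynomial (Fin 6) ℂ)).IsHomogeneous 2 :=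
    IsHomogeneous.pderiv (n := 3) F.2
  refine ⟨quadMatrix (pderiv 0 (F : MvPolynomial (Fin 6) ℂ)), quadMatrix_isSymm _, ?_,
    eval_eq_sum_quadMatrix hq⟩
  set w : Fin 6 → ℂ := fun i => if i < 3 then 1 else 0 with hw
  have hM : quadMatrix (pderiv 0 (F : MvPolynomial (Fin 6) ℂ)) =
      quadMatrix (pderiv 0 (F : MvPolynomial (Fin 6) ℂ)) * Matrix.diagonal w := by
    ext i j
    rw [Matrix.mul_diagonal]
    rcases lt_or_ge j 3 with hj | hj
    · simp [hw, hj]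
    · simp [quadMatrix, hF j hj]
  rw [hM]
  refine (Matrix.rank_mul_le_right _ _).trans ?_
  rw [Matrix.rank_diagonal]
  have : Fintype.card { i // w i ≠ 0 } ≤ Fintype.card { i : Fin 6 // i < 3 } := by
    refine Fintype.card_le_of_injective
      (fun i => ⟨i.1, by by_contra h; exact i.2 (by simp [hw, h])⟩) ?_
    intro a b h
    simpa [Subtype.ext_iff] using h
  exact this.trans (by decide)

lemma pderiv_eval_of_eval_eq {n : ℕ} {q : MvPolynomial (Fin n) ℂ} {M : Matrix (Fin n) (Fin n) ℂ}
    (hs : M.IsSymm) (hM : ∀ x : Fin n → ℂ, eval x q = ∑ i, ∑ j, M i j * x i * x j)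
    (x : Fin n → ℂ) (k : Fin n) : eval x (pderiv k q) = 2 * M.mulVec x k := by
  have hq : q = ∑ i, ∑ j, C (M i j) * X i * X j :=
    MvPolynomial.funext fun x => by simp [hM]
  have hs' : ∀ i j, M i j = M j i := fun i j => hs.apply j i
  simp only [hq, map_sum, pderiv_mul, pderiv_C, pderiv_X, Pi.single_apply, zero_mul, zero_add,
    map_add, map_mul, eval_C, eval_X, Finset.sum_add_distrib, Matrix.mulVec, dotProduct]
  have h1 : ∑ i, ∑ j, M i j * eval x (if i = k then 1 else 0) * x j = ∑ j, M k j * x j := by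
    rw [Finset.sum_eq_single k (fun i _ hi => by simp [hi]) (by simp)]
    simp
  have h2 : ∑ i, ∑ j, M i j * x i * eval x (if j = k then 1 else 0) = ∑ j, M k j * x j := by
    refine Finset.sum_congr rfl fun i _ => ?_
    rw [Finset.sum_eq_single k (fun j _ hj => by simp [hj]) (by simp)]
    simp [hs' i k]
  rw [h1, h2, two_mul]

lemma eval_pderiv_eq_mulVec {n : ℕ} {f : MvPolynomial (Fin n) ℂ} (hf : f.IsHomogeneous 3)
    {v : Fin n → ℂ} {M : Matrix (Fin n) (Fin n) ℂ} (hs : M.IsSymm)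
    (hM : ∀ x : Fin n → ℂ, eval x (pdir v f) = ∑ i, ∑ j, M i j * x i * x j) (k : Fin n) :
    eval v (pderiv k f) = M.mulVec v k := by
  have h1 := pderiv_eval_of_eval_eq hs hM v k
  have h2 := congrArg (eval v) (hf.pderiv (i := k)).sum_X_mul_pderiv
  simp only [pdir, map_sum, pderiv_C_mul, pderiv_comm k, map_mul, eval_C, eval_X,
    nsmul_eq_mul, Nat.add_one_sub_one, Nat.cast_ofNat] at h1 h2
  have h3 := h2.symm.trans h1
  simpa using h3

/-- A linearly independent family of prescribed columns `0, 3, 4, 5` extends to an invertible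
matrix. -/
lemma exists_isUnit_col_eq {v : Fin 6 → ℂ} {k : Fin 3 → Fin 6 → ℂ}
    (h : LinearIndependent ℂ (Fin.cons v k : Fin 4 → Fin 6 → ℂ)) :
    ∃ G : Matrix (Fin 6) (Fin 6) ℂ, IsUnit G ∧ G.col 0 = v ∧ G.col 3 = k 0 ∧ G.col 4 = k 1 ∧
      G.col 5 = k 2 := by
  obtain ⟨a, ha⟩ := exists_linearIndependent_cons_of_lt_finrank h (by simp)
  obtain ⟨b, hb⟩ := exists_linearIndependent_cons_of_lt_finrank ha (by simp)
  have hσ : Function.Injective (![2, 0, 1, 3, 4, 5] : Fin 6 → Fin 6) := by decide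
  have hc := hb.comp _ hσ
  refine ⟨(Matrix.of ((Fin.cons b (Fin.cons a (Fin.cons v k : Fin 4 → Fin 6 → ℂ) :
    Fin 5 → Fin 6 → ℂ) : Fin 6 → Fin 6 → ℂ) ∘ ![2, 0, 1, 3, 4, 5])).transpose, ?_, ?_, ?_, ?_, ?_⟩
  · rw [← Matrix.linearIndependent_cols_iff_isUnit]
    exact hc
  all_goals rfl

lemma exists_linearIndependent_mulVec_eq_zero {M : Matrix (Fin 6) (Fin 6) ℂ} (hr : M.rank ≤ 3) :
    ∃ k : Fin 3 → Fin 6 → ℂ, LinearIndependent ℂ k ∧ ∀ j, M.mulVec (k j) = 0 := by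
  have h := LinearMap.finrank_range_add_finrank_ker M.mulVecLin
  rw [Module.finrank_fin_fun] at h
  have h3 : 3 ≤ Module.finrank ℂ (LinearMap.ker M.mulVecLin) := by
    rw [Matrix.rank] at hr
    omega
  let b := Module.finBasis ℂ (LinearMap.ker M.mulVecLin)
  refine ⟨fun j => b (Fin.castLE h3 j), ?_, fun j => (b (Fin.castLE h3 j)).2⟩
  exact (b.linearIndependent.map' _ (Submodule.ker_subtype _)).comp _ (Fin.castLE_injective h3)

/-- The pullback of a cubic form along a linear map. -/
noncomputable def cubicPull (A : Matrix (Fin 6) (Fin 6) ℂ) (F : homogeneousSubmodule (Fin 6) ℂ 3) :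
    homogeneousSubmodule (Fin 6) ℂ 3 :=
  ⟨linSubst A (F : MvPolynomial (Fin 6) ℂ), isHomogeneous_linSubst A F.2⟩

lemma coe_cubicPull (A : Matrix (Fin 6) (Fin 6) ℂ) (F : homogeneousSubmodule (Fin 6) ℂ 3) :
    (cubicPull A F : MvPolynomial (Fin 6) ℂ) = linSubst A (F : MvPolynomial (Fin 6) ℂ) := rfl

lemma cubicPull_mul (A B : Matrix (Fin 6) (Fin 6) ℂ) (F : homogeneousSubmodule (Fin 6) ℂ 3) :
    cubicPull (A * B) F = cubicPull B (cubicPull A F) :=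
  Subtype.ext (linSubst_mul A B _)

/-- A smooth cubic with a partial derivative of rank at most `3` is linearly equivalent to an
adapted one. Smoothness enters because a cubic whose derivative `∂_v f` has `v` in its kernel is
singular at `v`. -/
lemma exists_cubicPull_eq {f : homogeneousSubmodule (Fin 6) ℂ 3}
    (hsm : ∀ x : Fin 6 → ℂ, x ≠ 0 →
      ∃ i : Fin 6, eval x (pderiv i (f : MvPolynomial (Fin 6) ℂ)) ≠ 0)
    {v : Fin 6 → ℂ} (hv : v ≠ 0) (hq : QuadRankLe (pdir v (f : MvPolynomial (Fin 6) ℂ)) 3) :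
    ∃ F ∈ adaptedCubics, ∃ A, f = cubicPull A F := by
  obtain ⟨M, hs, hr, hM⟩ := hq
  obtain ⟨k, hk, hk0⟩ := exists_linearIndependent_mulVec_eq_zero hr
  have hMv : M.mulVec v ≠ 0 := by
    obtain ⟨i, hi⟩ := hsm v hv
    rw [eval_pderiv_eq_mulVec f.2 hs hM] at hi
    exact fun h => hi (by rw [h, Pi.zero_apply])
  have hvk : LinearIndependent ℂ (Fin.cons v k : Fin 4 → Fin 6 → ℂ) := by
    refine linearIndependent_finCons.2 ⟨hk, fun hmem => hMv ?_⟩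
    have hle : Submodule.span ℂ (Set.range k) ≤ LinearMap.ker M.mulVecLin := by
      rw [Submodule.span_le]
      rintro _ ⟨j, rfl⟩
      exact hk0 j
    exact hle hmem
  obtain ⟨G, hG, h0, h3, h4, h5⟩ := exists_isUnit_col_eq hvk
  have hcol : ∀ j, 3 ≤ j → M.mulVec (G.col j) = 0 := by
    intro j hj
    fin_cases j
    · exact absurd hj (by decide)
    · exact absurd hj (by decide)
    · exact absurd hj (by decide)
    · exact (congrArg M.mulVec h3).trans (hk0 0)
    · exact (congrArg M.mulVec h4).trans (hk0 1)
    · exact (congrArg M.mulVec h5).trans (hk0 2)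
  refine ⟨cubicPull G f, ?_, G⁻¹, ?_⟩
  · rw [mem_adaptedCubics]
    intro j hj
    rw [coe_cubicPull, ← pdir_single _ 0, pdir_linSubst, Matrix.mulVec_single_one, h0, pderiv_linSubst]
    refine MvPolynomial.funext fun x => ?_
    simp only [map_sum, map_mul, eval_C, eval_linSubst, pderiv_eval_of_eval_eq hs hM, map_zero]
    have h : G.col j ⬝ᵥ M.mulVec (G.mulVec x) = 0 := by
      rw [Matrix.dotProduct_mulVec, ← Matrix.mulVec_transpose, hs.eq, hcol j hj, zero_dotProduct]
    have h' : ∑ i, G i j * (2 * M.mulVec (G.mulVec x) i) =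
        2 * (G.col j ⬝ᵥ M.mulVec (G.mulVec x)) := by
      rw [dotProduct, Finset.mul_sum]
      exact Finset.sum_congr rfl fun i _ => by simp only [Matrix.col_apply]; ring
    rw [h', h, mul_zero]
  · rw [← cubicPull_mul, Matrix.mul_nonsing_inv _ ((Matrix.isUnit_iff_isUnit_det _).1 hG)]
    exact Subtype.ext (linSubst_one _).symm

/-- The shear fixing `e₁, …, e₅` and mapping `(1, u)` to `e₀`. -/
def dirShear (u : Fin 5 → ℂ) : Matrix (Fin 6) (Fin 6) ℂ :=
  !![1, 0, 0, 0, 0, 0; -u 0, 1, 0, 0, 0, 0; -u 1, 0, 1, 0, 0, 0; -u 2, 0, 0, 1, 0, 0;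
    -u 3, 0, 0, 0, 1, 0; -u 4, 0, 0, 0, 0, 1]

/-- The unipotent block matrix with upper right block `B`. -/
def kerShear (B : Matrix (Fin 3) (Fin 3) ℂ) : Matrix (Fin 6) (Fin 6) ℂ :=
  !![1, 0, 0, B 0 0, B 0 1, B 0 2; 0, 1, 0, B 1 0, B 1 1, B 1 2; 0, 0, 1, B 2 0, B 2 1, B 2 2;
    0, 0, 0, 1, 0, 0; 0, 0, 0, 0, 1, 0; 0, 0, 0, 0, 0, 1]

lemma dirShear_mulVec (u : Fin 5 → ℂ) (x : Fin 6 → ℂ) :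
    (dirShear u).mulVec x = ![x 0, x 1 - u 0 * x 0, x 2 - u 1 * x 0, x 3 - u 2 * x 0,
      x 4 - u 3 * x 0, x 5 - u 4 * x 0] := by
  ext i
  fin_cases i <;> simp [dirShear, Matrix.mulVec, dotProduct, Fin.sum_univ_six] <;> ring

lemma kerShear_mulVec (B : Matrix (Fin 3) (Fin 3) ℂ) (x : Fin 6 → ℂ) :
    (kerShear B).mulVec x = ![x 0 + (B 0 0 * x 3 + B 0 1 * x 4 + B 0 2 * x 5),
      x 1 + (B 1 0 * x 3 + B 1 1 * x 4 + B 1 2 * x 5),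
      x 2 + (B 2 0 * x 3 + B 2 1 * x 4 + B 2 2 * x 5), x 3, x 4, x 5] := by
  ext i
  fin_cases i <;> simp [kerShear, Matrix.mulVec, dotProduct, Fin.sum_univ_six] <;> ring

lemma dirShear_neg_mul (u : Fin 5 → ℂ) : dirShear (-u) * dirShear u = 1 := by
  refine Matrix.ext_of_mulVec_single fun i => ?_
  rw [← Matrix.mulVec_mulVec, dirShear_mulVec, dirShear_mulVec, Matrix.one_mulVec]
  ext j
  fin_cases j <;> simp

lemma kerShear_neg_mul (B : Matrix (Fin 3) (Fin 3) ℂ) : kerShear (-B) * kerShear B = 1 := by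
  refine Matrix.ext_of_mulVec_single fun i => ?_
  rw [← Matrix.mulVec_mulVec, kerShear_mulVec, kerShear_mulVec, Matrix.one_mulVec]
  ext j
  fin_cases j <;> simp <;> ring

/-- A generic matrix is a product of shears, up to a factor preserving `⟨e₀⟩` and
`⟨e₃, e₄, e₅⟩`. -/
lemma exists_eq_mul_kerShear_mul_dirShear {A : Matrix (Fin 6) (Fin 6) ℂ} (h : A.det ≠ 0)
    (h5 : (A.submatrix Fin.succ Fin.succ).det ≠ 0)
    (h2 : (A.submatrix ![1, 2] ![1, 2]).det ≠ 0) :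
    ∃ u B P, A = P * (kerShear B * dirShear u) ∧ (∀ i, i ≠ 0 → P i 0 = 0) ∧
      ∀ i j, i < 3 → 3 ≤ j → P i j = 0 := by
  set u : Fin 5 → ℂ := (A.submatrix Fin.succ Fin.succ)⁻¹.mulVec (fun i => -A i.succ 0) with hu
  have hu' : (A.submatrix Fin.succ Fin.succ).mulVec u = fun i => -A i.succ 0 := by
    rw [hu, Matrix.mulVec_mulVec, Matrix.mul_nonsing_inv _ (isUnit_iff_ne_zero.2 h5),
      Matrix.one_mulVec]
  set N := A * dirShear (-u) with hN
  have hN0 : ∀ i, i ≠ 0 → N i 0 = 0 := by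
    intro i hi
    obtain ⟨k, rfl⟩ := Fin.exists_succ_eq.2 hi
    have := congrFun hu' k
    simp only [Matrix.mulVec, dotProduct, Matrix.submatrix_apply, Fin.sum_univ_five,
      Fin.reduceSucc] at this
    rw [hN, Matrix.mul_apply, Fin.sum_univ_six]
    simp [dirShear]
    linear_combination this
  have hNj : ∀ i j, j ≠ 0 → N i j = A i j := by
    intro i j hj
    rw [hN, Matrix.mul_apply, Fin.sum_univ_six]
    fin_cases j <;> simp [dirShear] at hj ⊢
  have hNdet : N.det ≠ 0 := by
    rw [hN, Matrix.det_mul]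
    have := congrArg Matrix.det (dirShear_neg_mul u)
    rw [Matrix.det_mul, Matrix.det_one] at this
    exact mul_ne_zero h (left_ne_zero_of_mul_eq_one this)
  have hl : N 0 0 ≠ 0 := by
    intro h0
    refine hNdet (Matrix.det_eq_zero_of_column_eq_zero 0 fun i => ?_)
    rcases eq_or_ne i 0 with rfl | hi
    exacts [h0, hN0 i hi]
  set N3 : Matrix (Fin 3) (Fin 3) ℂ := N.submatrix ![0, 1, 2] ![0, 1, 2] with hN3
  have hN3det : N3.det ≠ 0 := by
    have : N3.det = N 0 0 * (A.submatrix ![1, 2] ![1, 2]).det := by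
      rw [Matrix.det_fin_three, Matrix.det_fin_two]
      simp only [hN3, Matrix.submatrix_apply, Matrix.cons_val]
      rw [hN0 1 (by decide), hN0 2 (by decide), hNj 1 1 (by decide), hNj 1 2 (by decide),
        hNj 2 1 (by decide), hNj 2 2 (by decide)]
      ring
    rw [this]
    exact mul_ne_zero hl h2
  set B : Matrix (Fin 3) (Fin 3) ℂ := N3⁻¹ * N.submatrix ![0, 1, 2] ![3, 4, 5] with hB
  have hB' : N3 * B = N.submatrix ![0, 1, 2] ![3, 4, 5] := by
    rw [hB, Matrix.mul_nonsing_inv_cancel_left _ _ (isUnit_iff_ne_zero.2 hN3det)]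
  refine ⟨u, B, N * kerShear (-B), ?_, fun i hi => ?_, fun i j hi hj => ?_⟩
  · rw [Matrix.mul_assoc, ← Matrix.mul_assoc (kerShear (-B)), kerShear_neg_mul, Matrix.one_mul,
      hN, Matrix.mul_assoc, dirShear_neg_mul, Matrix.mul_one]
  · rw [Matrix.mul_apply, Fin.sum_univ_six]
    simp [kerShear, hN0 i hi]
  · obtain ⟨a, rfl⟩ : ∃ a : Fin 3, (![0, 1, 2] : Fin 3 → Fin 6) a = i := by
      revert i; decide
    obtain ⟨b, rfl⟩ : ∃ b : Fin 3, (![3, 4, 5] : Fin 3 → Fin 6) b = j := by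
      revert j; decide
    have := congrFun (congrFun hB' a) b
    simp only [Matrix.mul_apply, Fin.sum_univ_three, hN3, Matrix.submatrix_apply,
      Matrix.cons_val] at this
    rw [Matrix.mul_apply, Fin.sum_univ_six]
    fin_cases b <;> simp [kerShear] at this ⊢ <;> linear_combination -this

/-- The linear change of coordinates used to parametrize cubics with a derivative of rank `3`. -/
def shear (u : Fin 5 → ℂ) (B : Matrix (Fin 3) (Fin 3) ℂ) : Matrix (Fin 6) (Fin 6) ℂ :=
  kerShear B * dirShear u

lemma shear_mulVec (u : Fin 5 → ℂ) (B : Matrix (Fin 3) (Fin 3) ℂ) (x : Fin 6 → ℂ) :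
    (shear u B).mulVec x =
      ![x 0 + (B 0 0 * (x 3 - u 2 * x 0) + B 0 1 * (x 4 - u 3 * x 0) + B 0 2 * (x 5 - u 4 * x 0)),
        x 1 - u 0 * x 0 +
          (B 1 0 * (x 3 - u 2 * x 0) + B 1 1 * (x 4 - u 3 * x 0) + B 1 2 * (x 5 - u 4 * x 0)),
        x 2 - u 1 * x 0 +
          (B 2 0 * (x 3 - u 2 * x 0) + B 2 1 * (x 4 - u 3 * x 0) + B 2 2 * (x 5 - u 4 * x 0)),
        x 3 - u 2 * x 0, x 4 - u 3 * x 0, x 5 - u 4 * x 0] := by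
  rw [shear, ← Matrix.mulVec_mulVec, dirShear_mulVec, kerShear_mulVec]
  simp

lemma shear_mulVec_cons (u : Fin 5 → ℂ) (B : Matrix (Fin 3) (Fin 3) ℂ) :
    (shear u B).mulVec ![1, u 0, u 1, u 2, u 3, u 4] = Pi.single 0 1 := by
  rw [shear_mulVec]
  ext i
  fin_cases i <;> simp

/-- The pullback of an adapted cubic along a generic matrix is a pullback along a shear of an
adapted cubic. -/
lemma exists_cubicPull_shear_eq {A : Matrix (Fin 6) (Fin 6) ℂ} (h : A.det ≠ 0)
    (h5 : (A.submatrix Fin.succ Fin.succ).det ≠ 0)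
    (h2 : (A.submatrix ![1, 2] ![1, 2]).det ≠ 0) {F : homogeneousSubmodule (Fin 6) ℂ 3}
    (hF : F ∈ adaptedCubics) :
    ∃ u B, ∃ G ∈ adaptedCubics, cubicPull A F = cubicPull (shear u B) G := by
  obtain ⟨u, B, P, hA, hP0, hP3⟩ := exists_eq_mul_kerShear_mul_dirShear h h5 h2
  refine ⟨u, B, cubicPull P F, linSubst_mem_adaptedCubics hF hP0 hP3 (coe_cubicPull P F), ?_⟩
  rw [hA, cubicPull_mul]
  rfl

/-- For all but finitely many `s`, the determinant of `A + s` is nonzero. -/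
lemma Matrix.finite_setOf_det_add_smul_one_eq_zero {n : ℕ} (A : Matrix (Fin n) (Fin n) ℂ) :
    {s : ℂ | (A + s • (1 : Matrix (Fin n) (Fin n) ℂ)).det = 0}.Finite := by
  refine ((-A).charpoly.roots.toFinset.finite_toSet).subset fun s hs => ?_
  have hs' : (A + s • (1 : Matrix (Fin n) (Fin n) ℂ)).det = 0 := hs
  simp only [Finset.mem_coe, Multiset.mem_toFinset,
    Polynomial.mem_roots (-A).charpoly_monic.ne_zero, Polynomial.IsRoot.def, Matrix.eval_charpoly]
  rw [← hs', Matrix.scalar_apply, sub_neg_eq_add, add_comm, Matrix.smul_one_eq_diagonal]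

/-- All but finitely many translates of a matrix by scalars are generic. -/
lemma finite_setOf_not_generic (A : Matrix (Fin 6) (Fin 6) ℂ) :
    {s : ℂ | ¬ ((A + s • (1 : Matrix (Fin 6) (Fin 6) ℂ)).det ≠ 0 ∧
      ((A + s • (1 : Matrix (Fin 6) (Fin 6) ℂ)).submatrix Fin.succ Fin.succ).det ≠ 0 ∧
      ((A + s • (1 : Matrix (Fin 6) (Fin 6) ℂ)).submatrix ![1, 2] ![1, 2]).det ≠ 0)}.Finite := by
  have hsub : ∀ (n : ℕ) (g : Fin n → Fin 6), Function.Injective g → ∀ s : ℂ,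
      (A + s • (1 : Matrix (Fin 6) (Fin 6) ℂ)).submatrix g g =
        A.submatrix g g + s • (1 : Matrix (Fin n) (Fin n) ℂ) := by
    intro n g hg s
    ext i j
    simp [Matrix.one_apply, hg.eq_iff]
  refine ((Matrix.finite_setOf_det_add_smul_one_eq_zero A).union
    ((Matrix.finite_setOf_det_add_smul_one_eq_zero (A.submatrix Fin.succ Fin.succ)).union
      (Matrix.finite_setOf_det_add_smul_one_eq_zero (A.submatrix ![1, 2] ![1, 2])))).subset ?_
  intro s hs
  rw [Set.mem_ofPred_eq, hsub 5 _ (Fin.succ_injective 5), hsub 2 ![1, 2] (by decide)] at hs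
  simp only [Set.mem_union, Set.mem_ofPred_eq]
  tauto

/-- Evaluation at a point, as a linear form on the space of cubic forms. -/
noncomputable def evalForm (x : Fin 6 → ℂ) : homogeneousSubmodule (Fin 6) ℂ 3 →ₗ[ℂ] ℂ :=
  (aeval (R := ℂ) x).toLinearMap.comp (homogeneousSubmodule (Fin 6) ℂ 3).subtype

lemma evalForm_apply (x : Fin 6 → ℂ) (F : homogeneousSubmodule (Fin 6) ℂ 3) :
    evalForm x F = eval x (F : MvPolynomial (Fin 6) ℂ) := by
  simp [evalForm, aeval_eq_eval]

lemma span_range_evalForm [Module.Finite ℂ (homogeneousSubmodule (Fin 6) ℂ 3)] :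
    Submodule.span ℂ (Set.range evalForm) = ⊤ := by
  refine Submodule.span_eq_top_of_ne_zero fun F hF => ?_
  by_contra! h
  refine hF (Subtype.ext (MvPolynomial.funext fun x => ?_))
  have := h _ ⟨x, rfl⟩
  rw [evalForm_apply] at this
  simpa using this

/-- A linear property of functions holds for all linear forms along a family of cubics as soon as
it holds for evaluations. -/
lemma linearForm_comp_mem [Module.Finite ℂ (homogeneousSubmodule (Fin 6) ℂ 3)] {T : Type*}
    (W : Submodule ℂ (T → ℂ)) {φ : T → homogeneousSubmodule (Fin 6) ℂ 3}
    (h : ∀ x, (fun t => eval x (φ t : MvPolynomial (Fin 6) ℂ)) ∈ W)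
    (l : homogeneousSubmodule (Fin 6) ℂ 3 →ₗ[ℂ] ℂ) : (fun t => l (φ t)) ∈ W := by
  have hl : l ∈ Submodule.span ℂ (Set.range evalForm) := by
    rw [span_range_evalForm]
    trivial
  induction hl using Submodule.span_induction with
  | mem l hl =>
    obtain ⟨x, rfl⟩ := hl
    simpa only [evalForm_apply] using h x
  | zero => exact W.zero_mem
  | add l l' _ _ hl hl' => exact W.add_mem hl hl'
  | smul c l _ hl => exact W.smul_mem c hl

/-- The algebra of polynomial functions on `ℂⁿ`. -/
noncomputable def polyFun (n : ℕ) : Subalgebra ℂ ((Fin n → ℂ) → ℂ) :=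
  (aeval (R := ℂ) fun (i : Fin n) (y : Fin n → ℂ) => y i).range

lemma mem_polyFun {n : ℕ} {f : (Fin n → ℂ) → ℂ} :
    f ∈ polyFun n ↔ ∃ P : MvPolynomial (Fin n) ℂ, ∀ y, f y = eval y P := by
  have key : ∀ (P : MvPolynomial (Fin n) ℂ) (y : Fin n → ℂ),
      aeval (R := ℂ) (fun (i : Fin n) (y : Fin n → ℂ) => y i) P y = eval y P := by
    intro P y
    induction P using MvPolynomial.induction_on with
    | C a => simp
    | add p q hp hq => simp [hp, hq]
    | mul_X p i hp => simp [hp]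
  constructor
  · rintro ⟨P, rfl⟩
    exact ⟨P, key P⟩
  · rintro ⟨P, hP⟩
    exact ⟨P, funext fun y => (key P y).trans (hP y).symm⟩

lemma linearMap_mem_polyFun {n : ℕ} (l : (Fin n → ℂ) →ₗ[ℂ] ℂ) : (fun y => l y) ∈ polyFun n := by
  refine mem_polyFun.2 ⟨linForm fun i => l (Pi.single i 1), fun y => ?_⟩
  rw [eval_linForm, LinearMap.pi_apply_eq_sum_univ l y]
  exact Finset.sum_congr rfl fun i _ => by
    rw [smul_eq_mul, mul_comm]
    congr 2
    ext j
    simp [Pi.single_apply, eq_comm]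

lemma const_mem_polyFun {n : ℕ} (c : ℂ) : (fun _ => c) ∈ polyFun n :=
  (polyFun n).algebraMap_mem c

lemma eval_comp_mem_polyFun {n m : ℕ} {z : (Fin n → ℂ) → Fin m → ℂ}
    (hz : ∀ i, (fun y => z y i) ∈ polyFun n) (G : MvPolynomial (Fin m) ℂ) :
    (fun y => eval (z y) G) ∈ polyFun n := by
  induction G using MvPolynomial.induction_on with
  | C a => simpa using const_mem_polyFun a
  | add p q hp hq => simpa only [map_add] using! add_mem hp hq
  | mul_X p i hp => simpa only [map_mul, eval_X] using! mul_mem hp (hz i)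

instance : Module.Free ℂ adaptedCubics := Module.Free.of_divisionRing ℂ adaptedCubics

/-- The parameters of cubics with a derivative of rank at most `3`: a direction, the kernel of the
derivative in that direction, and an adapted cubic. -/
abbrev CubicParam : Type :=
  (Fin 5 → ℂ) × Matrix (Fin 3) (Fin 3) ℂ × adaptedCubics

/-- The cubic with given parameters. -/
noncomputable def paramCubic (t : CubicParam) : homogeneousSubmodule (Fin 6) ℂ 3 :=
  cubicPull (shear t.1 t.2.1) t.2.2

lemma eval_paramCubic (t : CubicParam) (x : Fin 6 → ℂ) :
    eval x (paramCubic t : MvPolynomial (Fin 6) ℂ) =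
      eval ((shear t.1 t.2.1).mulVec x) (t.2.2 : MvPolynomial (Fin 6) ℂ) := by
  rw [paramCubic, coe_cubicPull, eval_linSubst]

lemma quadRankLe_pdir_paramCubic (t : CubicParam) :
    ∃ v : Fin 6 → ℂ, v ≠ 0 ∧ QuadRankLe (pdir v (paramCubic t : MvPolynomial (Fin 6) ℂ)) 3 := by
  refine ⟨![1, t.1 0, t.1 1, t.1 2, t.1 3, t.1 4], fun h => one_ne_zero (congrFun h 0), ?_⟩
  rw [paramCubic, coe_cubicPull, pdir_linSubst, shear_mulVec_cons, pdir_single]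
  exact quadRankLe_linSubst (quadRankLe_pderiv_of_mem_adaptedCubics t.2.2.2) _

lemma finrank_cubicParam (e : homogeneousSubmodule (Fin 6) ℂ 3 ≃ₗ[ℂ] (Fin 56 → ℂ)) :
    Module.finrank ℂ CubicParam = 55 := by
  have : Module.Finite ℂ (homogeneousSubmodule (Fin 6) ℂ 3) := Module.Finite.equiv e.symm
  rw [Module.finrank_prod, Module.finrank_prod, finrank_adaptedCubics e, Module.finrank_matrix]
  simp

lemma shear_mulVec_mem_polyFun {n : ℕ} (b : (Fin n → ℂ) →ₗ[ℂ] CubicParam) (x : Fin 6 → ℂ)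
    (i : Fin 6) : (fun y => (shear (b y).1 (b y).2.1).mulVec x i) ∈ polyFun n := by
  have hu : ∀ k, (fun y => (b y).1 k) ∈ polyFun n := fun k =>
    linearMap_mem_polyFun ((LinearMap.proj k).comp ((LinearMap.fst ℂ _ _).comp b))
  have hB : ∀ k l, (fun y => (b y).2.1 k l) ∈ polyFun n := fun k l =>
    linearMap_mem_polyFun ((Matrix.entryLinearMap ℂ ℂ k l).comp
      ((LinearMap.fst ℂ _ _).comp ((LinearMap.snd ℂ _ _).comp b)))
  have hw : ∀ k c d, (fun y => c - (b y).1 k * d) ∈ polyFun n := fun k c d =>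
    sub_mem (const_mem_polyFun c) (mul_mem (hu k) (const_mem_polyFun d))
  have hz : ∀ k, (fun y => (b y).2.1 k 0 * (x 3 - (b y).1 2 * x 0) +
      (b y).2.1 k 1 * (x 4 - (b y).1 3 * x 0) + (b y).2.1 k 2 * (x 5 - (b y).1 4 * x 0)) ∈
      polyFun n := fun k =>
    add_mem (add_mem (mul_mem (hB k 0) (hw 2 _ _)) (mul_mem (hB k 1) (hw 3 _ _)))
      (mul_mem (hB k 2) (hw 4 _ _))
  simp only [shear_mulVec]
  fin_cases i
  exacts [add_mem (const_mem_polyFun _) (hz 0), add_mem (hw 0 _ _) (hz 1),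
    add_mem (hw 1 _ _) (hz 2), hw 2 _ _, hw 3 _ _, hw 4 _ _]

/-- The cubics with given parameters form a polynomial family. -/
lemma linearForm_paramCubic_mem_polyFun [Module.Finite ℂ (homogeneousSubmodule (Fin 6) ℂ 3)]
    {n : ℕ} (b : (Fin n → ℂ) →ₗ[ℂ] CubicParam)
    (l : homogeneousSubmodule (Fin 6) ℂ 3 →ₗ[ℂ] ℂ) :
    (fun y => l (paramCubic (b y))) ∈ polyFun n := by
  refine linearForm_comp_mem (polyFun n).toSubmodule (fun x => ?_) l
  rw [Subalgebra.mem_toSubmodule]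
  let β := Module.finBasis ℂ adaptedCubics
  have h : ∀ y, eval x (paramCubic (b y) : MvPolynomial (Fin 6) ℂ) =
      ∑ k, β.repr (b y).2.2 k * eval ((shear (b y).1 (b y).2.1).mulVec x)
        ((β k : homogeneousSubmodule (Fin 6) ℂ 3) : MvPolynomial (Fin 6) ℂ) := by
    intro y
    rw [eval_paramCubic]
    have h := congrArg ((evalForm ((shear (b y).1 (b y).2.1).mulVec x)).comp adaptedCubics.subtype)
      (β.sum_repr (b y).2.2)
    simp only [map_sum, map_smul, LinearMap.comp_apply, Submodule.subtype_apply, evalForm_apply,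
      smul_eq_mul] at h
    exact h.symm
  simp only [h]
  have hs := sum_mem (S := polyFun n) (t := Finset.univ)
    (f := fun k y => β.repr (b y).2.2 k * eval ((shear (b y).1 (b y).2.1).mulVec x)
        ((β k : homogeneousSubmodule (Fin 6) ℂ 3) : MvPolynomial (Fin 6) ℂ)) fun k _ =>
    mul_mem (linearMap_mem_polyFun ((β.coord k).comp
      ((LinearMap.snd ℂ _ _).comp ((LinearMap.snd ℂ _ _).comp b))))
      (eval_comp_mem_polyFun (shear_mulVec_mem_polyFun b x) _)
  convert hs using 1
  ext y
  simp

/-- Every pullback of an adapted cubic is a limit of parametrized cubics. -/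
lemma cubicPull_mem_closure (e : homogeneousSubmodule (Fin 6) ℂ 3 ≃ₗ[ℂ] (Fin 56 → ℂ))
    {F : homogeneousSubmodule (Fin 6) ℂ 3} (hF : F ∈ adaptedCubics)
    (A : Matrix (Fin 6) (Fin 6) ℂ) :
    e (cubicPull A F) ∈ closure (Set.range fun t => e (paramCubic t)) := by
  have : Module.Finite ℂ (homogeneousSubmodule (Fin 6) ℂ 3) := Module.Finite.equiv e.symm
  let W : Submodule ℂ (ℂ → ℂ) :=
    { carrier := {f | Continuous f}
      add_mem' := fun hf hg => Continuous.add hf hg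
      zero_mem' := continuous_zero
      smul_mem' := fun c _ hf => Continuous.const_smul hf c }
  have hcont : Continuous fun s : ℂ =>
      e (cubicPull (A + s • (1 : Matrix (Fin 6) (Fin 6) ℂ)) F) := by
    refine continuous_pi fun i => linearForm_comp_mem W (fun x => ?_)
      ((LinearMap.proj i).comp e.toLinearMap)
    change Continuous _
    simp only [coe_cubicPull, eval_linSubst]
    refine (MvPolynomial.continuous_eval _).comp ?_
    fun_prop
  have h0 : e (cubicPull A F) = e (cubicPull (A + (0 : ℂ) • (1 : Matrix (Fin 6) (Fin 6) ℂ)) F) := by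
    simp
  rw [h0]
  refine mem_closure_of_tendsto (hcont.tendsto' 0 _ rfl |>.mono_left nhdsWithin_le_nhds)
    (b := nhdsWithin 0 {0}ᶜ) ?_
  filter_upwards [(finite_setOf_not_generic A).eventually_cofinite_notMem.filter_mono
    (nhdsNE_le_cofinite (0 : ℂ))] with s hs
  replace hs := not_not.1 hs
  obtain ⟨u, B, G, hG, h⟩ := exists_cubicPull_shear_eq hs.1 hs.2.1 hs.2.2 hF
  exact ⟨(u, B, ⟨G, hG⟩), by rw [h]; rfl⟩

/-- The cubic fourfold defined by `f` is smooth. -/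
def SmoothCubic (f : homogeneousSubmodule (Fin 6) ℂ 3) : Prop :=
  ∀ x : Fin 6 → ℂ, x ≠ 0 → ∃ i : Fin 6, eval x (pderiv i (f : MvPolynomial (Fin 6) ℂ)) ≠ 0

lemma MvPolynomial.IsHomogeneous.eval_smul_eq {σ : Type*} {n : ℕ} {q : MvPolynomial σ ℂ}
    (hq : q.IsHomogeneous n) (c : ℂ) (x : σ → ℂ) : eval (c • x) q = c ^ n * eval x q := by
  rw [eval_eq, eval_eq, Finset.mul_sum]
  refine Finset.sum_congr rfl fun d hd => ?_
  have hdeg : ∑ i ∈ d.support, d i = n := by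
    by_contra h
    exact mem_support_iff.1 hd (hq.coeff_eq_zero h)
  simp only [Pi.smul_apply, smul_eq_mul, mul_pow, Finset.prod_mul_distrib]
  rw [Finset.prod_pow_eq_pow_sum, hdeg]
  ring

/-- Smoothness is an open condition. -/
lemma isOpen_setOf_smoothCubic (e : homogeneousSubmodule (Fin 6) ℂ 3 ≃ₗ[ℂ] (Fin 56 → ℂ)) :
    IsOpen {c | SmoothCubic (e.symm c)} := by
  rw [← isClosed_compl_iff]
  let D : (Fin 6) → (Fin 6 → ℂ) → (Fin 56 → ℂ) →ₗ[ℂ] ℂ := fun i x =>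
    (aeval (R := ℂ) x).toLinearMap.comp ((pderiv (R := ℂ) i).toLinearMap.comp
      ((homogeneousSubmodule (Fin 6) ℂ 3).subtype.comp e.symm.toLinearMap))
  have hD : ∀ i x c, D i x c = eval x (pderiv i (e.symm c : MvPolynomial (Fin 6) ℂ)) := by
    intro i x c
    simp [D, aeval_eq_eval]
  let Z : Set (Metric.sphere (0 : Fin 6 → ℂ) 1 × (Fin 56 → ℂ)) :=
    {z | ∀ i, D i z.1 z.2 = 0}
  have hZ : IsClosed Z := by
    have hset : Z = ⋂ i, {z | D i z.1 z.2 = 0} := by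
      ext z
      simp [Z]
    rw [hset]
    refine isClosed_iInter fun i => isClosed_eq ?_ continuous_const
    have : ∀ z : Metric.sphere (0 : Fin 6 → ℂ) 1 × (Fin 56 → ℂ), D i z.1 z.2 =
        ∑ k, z.2 k * eval (z.1 : Fin 6 → ℂ)
          (pderiv i (e.symm (fun j => if k = j then 1 else 0) : MvPolynomial (Fin 6) ℂ)) := by
      intro z
      rw [LinearMap.pi_apply_eq_sum_univ (D i z.1) z.2]
      simp only [hD, smul_eq_mul]
    simp only [this]
    refine continuous_finsetSum _ fun k _ => ?_
    refine Continuous.mul (by fun_prop) ?_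
    exact (MvPolynomial.continuous_eval _).comp (by fun_prop)
  convert isClosedMap_snd_of_compactSpace Z hZ using 1
  ext c
  simp only [Set.mem_compl_iff, SmoothCubic, Set.mem_image, Prod.exists, exists_eq_right, Z,
    Set.mem_ofPred_eq, hD, Subtype.exists, mem_sphere_zero_iff_norm]
  push Not
  constructor
  · rintro ⟨x, hx, h⟩
    have hn : ‖x‖ ≠ 0 := norm_ne_zero_iff.2 hx
    refine ⟨((‖x‖ : ℂ)⁻¹) • x, ?_, fun i => ?_⟩
    · rw [norm_smul, norm_inv, Complex.norm_real, norm_norm, inv_mul_cancel₀ hn]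
    · have hq : (pderiv i (e.symm c : MvPolynomial (Fin 6) ℂ)).IsHomogeneous 2 :=
        IsHomogeneous.pderiv (n := 3) (e.symm c).2
      rw [hq.eval_smul_eq, h i, mul_zero]
  · rintro ⟨x, hx, h⟩
    exact ⟨x, fun h0 => by simp [h0] at hx, h⟩

/-- The Fermat cubic. -/
noncomputable def fermatCubic : homogeneousSubmodule (Fin 6) ℂ 3 :=
  ⟨∑ i, X i ^ 3, IsHomogeneous.sum _ _ _ fun i _ => isHomogeneous_X_pow i 3⟩

lemma pderiv_fermatCubic (i : Fin 6) :
    pderiv i (fermatCubic : MvPolynomial (Fin 6) ℂ) = 3 * X i ^ 2 := by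
  simp only [fermatCubic, map_sum, pderiv_pow, pderiv_X]
  rw [Finset.sum_eq_single i (fun j _ hj => by simp [hj]) (by simp)]
  simp

lemma smoothCubic_fermatCubic : SmoothCubic fermatCubic := by
  intro x hx
  obtain ⟨i, hi⟩ := Function.ne_iff.1 hx
  refine ⟨i, ?_⟩
  rw [pderiv_fermatCubic]
  simpa using hi

lemma fermatCubic_mem_adaptedCubics : fermatCubic ∈ adaptedCubics := by
  rw [mem_adaptedCubics]
  intro j hj
  have h : j ≠ 0 := by rintro rfl; exact absurd hj (by decide)
  have h3 : (3 : MvPolynomial (Fin 6) ℂ) = C 3 := rfl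
  rw [pderiv_fermatCubic, h3, pderiv_C_mul, pderiv_pow, pderiv_X, Pi.single_eq_of_ne' h]
  simp

lemma shear_zero : shear 0 0 = 1 := by
  refine Matrix.ext_of_mulVec_single fun i => ?_
  rw [shear_mulVec, Matrix.one_mulVec]
  ext j
  fin_cases j <;> simp

lemma paramCubic_zero_zero (F : adaptedCubics) : paramCubic (0, 0, F) = F := by
  refine Subtype.ext ?_
  rw [paramCubic, coe_cubicPull, shear_zero, linSubst_one]

/-- An adapted cubic at which the parametrization is immersive. -/
noncomputable def immersiveCubic : homogeneousSubmodule (Fin 6) ℂ 3 :=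
  ⟨X 0 * (X 0 * X 0) + X 0 * (X 1 * X 1) + X 0 * (X 2 * X 2) + X 1 * (X 3 * X 4) +
      X 2 * (X 3 * X 5) + X 3 * (X 3 * X 3) + X 4 * (X 4 * X 4) + X 5 * (X 5 * X 5), by
    have h : ∀ i j k : Fin 6, X i * (X j * X k) ∈ homogeneousSubmodule (Fin 6) ℂ 3 :=
      fun i j k => (isHomogeneous_X ℂ i).mul ((isHomogeneous_X ℂ j).mul (isHomogeneous_X ℂ k))
    repeat' first | exact h _ _ _ | apply Submodule.add_mem⟩

lemma eval_hessian_immersiveCubic (x : Fin 6 → ℂ) (i : Fin 6) :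
    (fun j => eval x (pderiv j (pderiv i (immersiveCubic : MvPolynomial (Fin 6) ℂ)))) =
      ![![6 * x 0, 2 * x 1, 2 * x 2, 0, 0, 0], ![2 * x 1, 2 * x 0, 0, x 4, x 3, 0],
        ![2 * x 2, 0, 2 * x 0, x 5, 0, x 3], ![0, x 4, x 5, 6 * x 3, x 1, x 2],
        ![0, x 3, 0, x 1, 6 * x 4, 0], ![0, 0, x 3, x 2, 0, 6 * x 5]] i := by
  ext j
  fin_cases i <;> fin_cases j <;>
    simp [immersiveCubic, pderiv_X] <;> ring

lemma immersiveCubic_mem_adaptedCubics : immersiveCubic ∈ adaptedCubics := by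
  rw [mem_adaptedCubics]
  intro j hj
  refine MvPolynomial.funext fun x => ?_
  have h := congrFun (eval_hessian_immersiveCubic x 0) j
  rw [map_zero]
  refine h.trans ?_
  fin_cases j <;> first | rfl | exact absurd hj (by decide)

lemma MvPolynomial.hasDerivAt_eval_comp {m : ℕ} {z : ℂ → Fin m → ℂ} {z' : Fin m → ℂ} {s : ℂ}
    (hz : ∀ i, HasDerivAt (fun t => z t i) (z' i) s) (G : MvPolynomial (Fin m) ℂ) :
    HasDerivAt (fun t => eval (z t) G) (∑ i, eval (z s) (pderiv i G) * z' i) s := by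
  induction G using MvPolynomial.induction_on with
  | C a => simpa using hasDerivAt_const s a
  | add p q hp hq => simpa [add_mul, Finset.sum_add_distrib] using! hp.add hq
  | mul_X p k hp =>
    have h := hp.mul (hz k)
    simp only [map_mul, eval_X]
    convert! h using 1
    simp only [pderiv_mul, pderiv_X, map_add, map_mul, eval_X, add_mul, Finset.sum_add_distrib,
      Finset.sum_mul]
    congr 1
    · exact Finset.sum_congr rfl fun i _ => by ring
    · rw [Finset.sum_eq_single k (fun i _ hi => by simp [hi.symm]) (by simp)]
      simp

/-- The derivative of `shear` at the origin. -/
def shearDeriv (u : Fin 5 → ℂ) (B : Matrix (Fin 3) (Fin 3) ℂ) : Matrix (Fin 6) (Fin 6) ℂ :=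
  !![0, 0, 0, B 0 0, B 0 1, B 0 2; -u 0, 0, 0, B 1 0, B 1 1, B 1 2;
    -u 1, 0, 0, B 2 0, B 2 1, B 2 2; -u 2, 0, 0, 0, 0, 0; -u 3, 0, 0, 0, 0, 0;
    -u 4, 0, 0, 0, 0, 0]

lemma hasDerivAt_shear_mulVec (u : Fin 5 → ℂ) (B : Matrix (Fin 3) (Fin 3) ℂ) (x : Fin 6 → ℂ)
    (i : Fin 6) : HasDerivAt (fun t : ℂ => (shear (t • u) (t • B)).mulVec x i)
      ((shearDeriv u B).mulVec x i) 0 := by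
  have hlin : ∀ c d a : ℂ, HasDerivAt (fun t : ℂ => c - t * a * d) (-(a * d)) 0 := by
    intro c d a
    have := (((hasDerivAt_id (0 : ℂ)).mul_const a).mul_const d).const_sub c
    simpa using this
  have hmul : ∀ b c d a : ℂ, HasDerivAt (fun t : ℂ => t * b * (c - t * a * d)) (b * c) 0 := by
    intro b c d a
    have := ((hasDerivAt_id (0 : ℂ)).mul_const b).mul (hlin c d a)
    simpa using! this
  have hz : ∀ k, HasDerivAt (fun t : ℂ => t * B k 0 * (x 3 - t * u 2 * x 0) +
      t * B k 1 * (x 4 - t * u 3 * x 0) + t * B k 2 * (x 5 - t * u 4 * x 0))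
      (B k 0 * x 3 + B k 1 * x 4 + B k 2 * x 5) 0 := fun k =>
    ((hmul _ _ _ _).add (hmul _ _ _ _)).add (hmul _ _ _ _)
  simp only [shear_mulVec, Pi.smul_apply, Matrix.smul_apply, smul_eq_mul]
  fin_cases i
  · convert! (hz 0).const_add (x 0) using 1
    simp [shearDeriv, Matrix.mulVec, dotProduct, Fin.sum_univ_six]
  · convert! (hlin (x 1) (x 0) (u 0)).add (hz 1) using 1
    simp [shearDeriv, Matrix.mulVec, dotProduct, Fin.sum_univ_six]
    ring
  · convert! (hlin (x 2) (x 0) (u 1)).add (hz 2) using 1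
    simp [shearDeriv, Matrix.mulVec, dotProduct, Fin.sum_univ_six]
    ring
  · convert! hlin (x 3) (x 0) (u 2) using 1
    simp [shearDeriv, Matrix.mulVec, dotProduct, Fin.sum_univ_six]
  · convert! hlin (x 4) (x 0) (u 3) using 1
    simp [shearDeriv, Matrix.mulVec, dotProduct, Fin.sum_univ_six]
  · convert! hlin (x 5) (x 0) (u 4) using 1
    simp [shearDeriv, Matrix.mulVec, dotProduct, Fin.sum_univ_six]

lemma hasDerivAt_eval_paramCubic (F : adaptedCubics) (t' : CubicParam) (x : Fin 6 → ℂ) :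
    HasDerivAt (fun t : ℂ => eval x
        (paramCubic ((0, 0, F) + t • t') : MvPolynomial (Fin 6) ℂ))
      (eval x (t'.2.2 : MvPolynomial (Fin 6) ℂ) +
        ∑ i, eval x (pderiv i (F : MvPolynomial (Fin 6) ℂ)) *
          (shearDeriv t'.1 t'.2.1).mulVec x i) 0 := by
  have h := fun G : MvPolynomial (Fin 6) ℂ =>
    hasDerivAt_eval_comp (hasDerivAt_shear_mulVec t'.1 t'.2.1 x) G
  have h1 := (h (F : MvPolynomial (Fin 6) ℂ)).add
    ((hasDerivAt_id (0 : ℂ)).mul (h (t'.2.2 : MvPolynomial (Fin 6) ℂ)))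
  simp only [zero_smul, shear_zero, Matrix.one_mulVec, id, zero_mul, add_zero, one_mul] at h1
  rw [add_comm]
  convert! h1 using 1
  ext t
  rw [eval_paramCubic]
  simp [smul_eval]

/-- If a first order deformation of the parameters leaves the immersive cubic unchanged, then it
is trivial. -/
lemma eq_zero_of_shearDeriv_eq_zero (t' : CubicParam)
    (h : ∀ x, eval x (t'.2.2 : MvPolynomial (Fin 6) ℂ) +
      ∑ i, eval x (pderiv i (immersiveCubic : MvPolynomial (Fin 6) ℂ)) *
        (shearDeriv t'.1 t'.2.1).mulVec x i = 0) : t' = 0 := by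
  obtain ⟨u, B, G⟩ := t'
  set D := shearDeriv u B with hD
  have hpoly : (G : MvPolynomial (Fin 6) ℂ) +
      ∑ i, pderiv i (immersiveCubic : MvPolynomial (Fin 6) ℂ) * linForm (D i) = 0 := by
    refine MvPolynomial.funext fun x => ?_
    simpa [eval_linForm, Matrix.mulVec, dotProduct] using h x
  have hG := mem_adaptedCubics.1 G.2
  have hI := mem_adaptedCubics.1 immersiveCubic_mem_adaptedCubics
  have key : ∀ j, 3 ≤ j → ∀ x : Fin 6 → ℂ,
      ∑ i, (eval x (pderiv i (pderiv 0 (immersiveCubic : MvPolynomial (Fin 6) ℂ))) * D i j +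
        eval x (pderiv i (pderiv j (immersiveCubic : MvPolynomial (Fin 6) ℂ))) * D i 0) = 0 := by
    intro j hj x
    have hp := congrArg (fun q => eval x (pderiv j (pderiv 0 q))) hpoly
    simp only [map_add, map_sum, hG j hj, pderiv_mul, pderiv_linForm, pderiv_C, map_mul, eval_C,
      map_zero, mul_zero, add_zero, zero_add] at hp
    rw [← hp]
    refine Finset.sum_congr rfl fun i _ => ?_
    rw [pderiv_comm 0 i, pderiv_comm j i (pderiv 0 _), pderiv_comm j i, hI j hj]
    simp
  have key' : ∀ j, 3 ≤ j → ∀ x : Fin 6 → ℂ,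
      6 * x 0 * D 0 j + 2 * x 1 * D 1 j + 2 * x 2 * D 2 j +
        ∑ i, eval x (pderiv i (pderiv j (immersiveCubic : MvPolynomial (Fin 6) ℂ))) * D i 0 = 0 := by
    intro j hj x
    rw [← key j hj x, Finset.sum_add_distrib]
    congr 1
    have h0 := congrFun (eval_hessian_immersiveCubic x 0)
    simp [h0, Fin.sum_univ_six]
  have h3 := key' 3 (by decide)
  have h4 := key' 4 (by decide)
  have h5 := key' 5 (by decide)
  have e3 := fun x => congrFun (eval_hessian_immersiveCubic x 3)
  have e4 := fun x => congrFun (eval_hessian_immersiveCubic x 4)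
  have e5 := fun x => congrFun (eval_hessian_immersiveCubic x 5)
  simp only [e3, e4, e5, Fin.sum_univ_six, hD, shearDeriv, Matrix.cons_val, Matrix.of_apply,
    Matrix.cons_val', Matrix.cons_val_zero, Matrix.cons_val_one] at h3 h4 h5
  have hu : u = 0 := by
    ext k
    fin_cases k
    · simpa using h3 (Pi.single 4 1)
    · simpa using h3 (Pi.single 5 1)
    · simpa using h3 (Pi.single 3 1)
    · simpa using h4 (Pi.single 4 1)
    · simpa using h5 (Pi.single 5 1)
  subst hu
  have hB : B = 0 := by
    ext a k
    fin_cases a <;> fin_cases k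
    · simpa using h3 (Pi.single 0 1)
    · simpa using h4 (Pi.single 0 1)
    · simpa using h5 (Pi.single 0 1)
    · simpa using h3 (Pi.single 1 1)
    · simpa using h4 (Pi.single 1 1)
    · simpa using h5 (Pi.single 1 1)
    · simpa using h3 (Pi.single 2 1)
    · simpa using h4 (Pi.single 2 1)
    · simpa using h5 (Pi.single 2 1)
  subst hB
  have hD0 : D = 0 := by
    ext i j
    fin_cases i <;> fin_cases j <;> simp [hD, shearDeriv]
  have hG0 : G = 0 := by
    refine Subtype.ext (Subtype.ext (MvPolynomial.funext fun x => ?_))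
    simpa [hD0] using h x
  rw [hG0]
  rfl

lemma mem_vanishingIdealOf {S : Set (Fin 56 → ℂ)} {P : MvPolynomial (Fin 56) ℂ} :
    P ∈ vanishingIdealOf S ↔ ∀ x ∈ S, eval x P = 0 := by
  simp [vanishingIdealOf, Submodule.mem_iInf]

/-- **Lemma 2.1.** The smooth cubic fourfolds with a partial derivative of rank at most 3
form (a set whose Zariski closure is) an irreducible hypersurface in the 56-dimensional
space of cubic forms: the vanishing ideal is prime of height 1. -/
theorem statement4 :
    ∀ e : (homogeneousSubmodule (Fin 6) ℂ 3) ≃ₗ[ℂ] (Fin 56 → ℂ),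
      IsHeightOnePrime (vanishingIdealOf (e ''
        {f : homogeneousSubmodule (Fin 6) ℂ 3 |
          (∀ x : Fin 6 → ℂ, x ≠ 0 →
            ∃ i : Fin 6, eval x (pderiv i (f : MvPolynomial (Fin 6) ℂ)) ≠ 0) ∧
          ∃ v : Fin 6 → ℂ, v ≠ 0 ∧ QuadRankLe (pdir v (f : MvPolynomial (Fin 6) ℂ)) 3})) := by
  intro e
  have : Module.Finite ℂ (homogeneousSubmodule (Fin 6) ℂ 3) := Module.Finite.equiv e.symm
  let b : (Fin 55 → ℂ) ≃ₗ[ℂ] CubicParam := LinearEquiv.ofFinrankEq _ _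
    ((Module.finrank_fin_fun ℂ).trans (finrank_cubicParam e).symm)
  choose p hp using fun i => mem_polyFun.1 (linearForm_paramCubic_mem_polyFun b.toLinearMap
    ((LinearMap.proj i).comp e.toLinearMap))
  have hp' : ∀ y, e (paramCubic (b y)) = fun i => eval y (p i) := fun y => funext fun i => hp i y
  have hI : vanishingIdealOf (e '' {f : homogeneousSubmodule (Fin 6) ℂ 3 |
      (∀ x : Fin 6 → ℂ, x ≠ 0 →
        ∃ i : Fin 6, eval x (pderiv i (f : MvPolynomial (Fin 6) ℂ)) ≠ 0) ∧
      ∃ v : Fin 6 → ℂ, v ≠ 0 ∧ QuadRankLe (pdir v (f : MvPolynomial (Fin 6) ℂ)) 3}) =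
      RingHom.ker (aeval (R := ℂ) p) := by
    ext P
    rw [mem_vanishingIdealOf, RingHom.mem_ker]
    constructor
    · intro h
      have hcont : Continuous fun (y : Fin 55 → ℂ) (i : Fin 56) => eval y (p i) :=
        continuous_pi fun i => MvPolynomial.continuous_eval (p i)
      refine eq_zero_of_eval_eq_zero_of_isOpen ((isOpen_setOf_smoothCubic e).preimage hcont)
        ⟨b.symm (0, 0, ⟨fermatCubic, fermatCubic_mem_adaptedCubics⟩), ?_⟩ fun y hy => ?_
      · rw [Set.mem_preimage, ← hp', LinearEquiv.apply_symm_apply, paramCubic_zero_zero]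
        simpa using! smoothCubic_fermatCubic
      · rw [eval_aeval, ← hp']
        rw [Set.mem_preimage, ← hp'] at hy
        refine h _ ⟨_, ⟨?_, quadRankLe_pdir_paramCubic (b y)⟩, rfl⟩
        simpa [SmoothCubic] using! hy
    · rintro h _ ⟨f, ⟨hf, v, hv, hq⟩, rfl⟩
      obtain ⟨F, hF, A, rfl⟩ := exists_cubicPull_eq hf hv hq
      have hcl : IsClosed {c | eval c P = 0} :=
        isClosed_eq (MvPolynomial.continuous_eval P) continuous_const
      refine closure_minimal ?_ hcl (cubicPull_mem_closure e hF A)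
      rintro _ ⟨t, rfl⟩
      have ht := hp' (b.symm t)
      rw [LinearEquiv.apply_symm_apply] at ht
      change eval (e (paramCubic t)) P = 0
      rw [ht, ← eval_aeval, h, map_zero]
  rw [hI]
  let t₀ : CubicParam := (0, 0, ⟨immersiveCubic, immersiveCubic_mem_adaptedCubics⟩)
  refine isHeightOnePrime_ker_aeval p (b.symm t₀) ?_
  rw [injective_iff_map_eq_zero]
  intro y' hy'
  have hdiff : DifferentiableAt ℂ (fun z i => eval z (p i)) (b.symm t₀) :=
    (contDiff_pi.2 fun i => contDiff_eval (p i)).differentiable one_ne_zero _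
  have hline := hdiff.hasFDerivAt.hasLineDerivAt y'
  rw [hy', HasLineDerivAt] at hline
  refine (LinearEquiv.map_eq_zero_iff b).1 (eq_zero_of_shearDeriv_eq_zero (b y') fun x => ?_)
  let L := ((evalForm x).comp e.symm.toLinearMap).toContinuousLinearMap
  have h1 := L.hasFDerivAt.comp_hasDerivAt (0 : ℂ) hline
  rw [map_zero] at h1
  refine (hasDerivAt_eval_paramCubic ⟨immersiveCubic, immersiveCubic_mem_adaptedCubics⟩
    (b y') x).unique ?_
  convert! h1 using 1
  ext t
  simp only [Function.comp_apply, ← hp']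
  simp [L, evalForm_apply, t₀]
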